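/- arXiv:1712.05040 — 6 statements merged into one kernel-verified Lean document; each statement's English description precedes it below -/
import Mathlib

section
/- Let γ > 1 and let C, L be reals with C > L > 0. Set m = ⌈(C − L)/(L·(γ − 1))⌉ and assume m ≥ 2. If C' = C + (m − 1)·L, then C' ≤ (1 + 1/(γ − 1))·C. -/
/-- Theorem 3 (gamma-inflation): with `m = ⌈(C − L)/(L·(γ − 1))⌉ ≥ 2`,
the total budget `C' = C + (m − 1)·L` satisfies `C' ≤ (1 + 1/(γ − 1))·C`. -/
theorem stmt_0 (γ C L : ℝ) (hγ : 1 < γ) (hL : 0 < L) (hCL : L < C)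
    (m : ℤ) (hm : m = ⌈(C - L) / (L * (γ - 1))⌉) (hm2 : 2 ≤ m)
    (C' : ℝ) (hC' : C' = C + ((m : ℝ) - 1) * L) :
    C' ≤ (1 + 1 / (γ - 1)) * C := by
  have hγ' : 0 < γ - 1 := sub_pos.mpr hγ
  have hlt : (m : ℝ) - 1 < (C - L) / (L * (γ - 1)) := by
    rw [hm]
    linarith [Int.ceil_lt_add_one ((C - L) / (L * (γ - 1)))]
  have hbound : ((m : ℝ) - 1) * L ≤ 1 / (γ - 1) * C := by
    rw [lt_div_iff₀ (mul_pos hL hγ')] at hlt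
    rw [one_div_mul_eq_div, le_div_iff₀ hγ']
    linarith
  rw [hC']
  linarith
end

section
/- Let C, L, D be reals with C > L > 0 and D > L, and set m = ⌈(C − L)/(D − L)⌉ and γ* = 1 + (C − L)/(m·L). Then ⌈(C − L)/(L·(γ* − 1))⌉ = m, and for every γ with 1 < γ < γ* one has ⌈(C − L)/(L·(γ − 1))⌉ > m; that is, γ* is the smallest γ achieving the minimal number m of equal reservation servers. -/
/-- `γ* = 1 + (C − L)/(m·L)` is the smallest `γ` achieving the minimal
number `m = ⌈(C − L)/(D − L)⌉` of equal reservation servers. -/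
theorem stmt_5 (C L D : ℝ) (hL : 0 < L) (hCL : L < C) (hDL : L < D)
    (m : ℤ) (hm : m = ⌈(C - L) / (D - L)⌉)
    (γstar : ℝ) (hγstar : γstar = 1 + (C - L) / ((m : ℝ) * L)) :
    ⌈(C - L) / (L * (γstar - 1))⌉ = m ∧
      ∀ γ : ℝ, 1 < γ → γ < γstar → ⌈(C - L) / (L * (γ - 1))⌉ > m := by
  have hCL' : 0 < C - L := sub_pos.2 hCL
  have hm_pos : (0 : ℝ) < m := by
    rw [hm]
    exact_mod_cast Int.ceil_pos.2 (div_pos hCL' (sub_pos.2 hDL))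
  have hsub : γstar - 1 = (C - L) / (m * L) := by rw [hγstar]; ring
  constructor
  · have h : (C - L) / (L * (γstar - 1)) = m := by
      rw [hsub]
      field_simp
    rw [h, Int.ceil_intCast]
  · intro γ hγ hlt
    have hγ' : 0 < γ - 1 := sub_pos.2 hγ
    have h : γ - 1 < (C - L) / (m * L) := by linarith
    rw [lt_div_iff₀ (mul_pos hm_pos hL)] at h
    rw [gt_iff_lt, Int.lt_ceil, lt_div_iff₀ (mul_pos hL hγ')]
    linarith
end

section
/- Let C, L, D be reals with C > L > 0 and D > L. Set m = ⌈(C − L)/(D − L)⌉ and E = (1 + (C − L)/(m·L))·L. Then m·E = C + (m − 1)·L (so the reservation condition C + L·(m − 1) ≤ m·E holds with equality) and L < E ≤ D (so each budget satisfies the budget constraints). -/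
/-- R-MIN: with `m = ⌈(C − L)/(D − L)⌉` and `E = (1 + (C − L)/(m·L))·L`,
the reservation condition holds with equality and `L < E ≤ D`. -/
theorem stmt_6 (C L D : ℝ) (hL : 0 < L) (hCL : L < C) (hDL : L < D)
    (m : ℤ) (hm : m = ⌈(C - L) / (D - L)⌉)
    (E : ℝ) (hE : E = (1 + (C - L) / ((m : ℝ) * L)) * L) :
    (m : ℝ) * E = C + ((m : ℝ) - 1) * L ∧ L < E ∧ E ≤ D := by
  have hDL' : 0 < D - L := sub_pos.mpr hDL
  have hCL' : 0 < C - L := sub_pos.mpr hCL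
  have hm_pos : (0 : ℝ) < m := by
    rw [hm]
    exact_mod_cast Int.ceil_pos.mpr (div_pos hCL' hDL')
  have hE' : E = L + (C - L) / m := by
    rw [hE]
    field_simp
  refine ⟨?_, ?_, ?_⟩
  · rw [hE']
    field_simp
    ring
  · rw [hE']
    exact lt_add_of_pos_right L (div_pos hCL' hm_pos)
  · have hle : (C - L) / (D - L) ≤ m := hm ▸ Int.le_ceil _
    have hdiv : (C - L) / m ≤ D - L := (div_le_comm₀ hDL' hm_pos).mp hle
    linarith
end

section
/- Let γ > 1 and let C, L be reals with L > 0 and C > γ·L. Set m = ⌈(C − L)/(L·(γ − 1))⌉ and E = (C + (m − 1)·L)/m. Then m ≥ 2, E ≤ γ·L, and the total budget satisfies m·E = C + (m − 1)·L ≤ (1 + 1/(γ − 1))·C. -/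
/-- R-EQUAL on a heavy task (`C > γ·L`): with `m = ⌈(C − L)/(L·(γ − 1))⌉`
and `E = (C + (m − 1)·L)/m`, one has `m ≥ 2`, `E ≤ γ·L`, and
`m·E = C + (m − 1)·L ≤ (1 + 1/(γ − 1))·C`. -/
theorem stmt_9 (γ C L : ℝ) (hγ : 1 < γ) (hL : 0 < L) (hheavy : γ * L < C)
    (m : ℤ) (hm : m = ⌈(C - L) / (L * (γ - 1))⌉)
    (E : ℝ) (hE : E = (C + ((m : ℝ) - 1) * L) / (m : ℝ)) :
    2 ≤ m ∧ E ≤ γ * L ∧ (m : ℝ) * E = C + ((m : ℝ) - 1) * L ∧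
      C + ((m : ℝ) - 1) * L ≤ (1 + 1 / (γ - 1)) * C := by
  have hγ' : 0 < γ - 1 := sub_pos.2 hγ
  have hd : 0 < L * (γ - 1) := mul_pos hL hγ'
  have hm_two : 2 ≤ m := by
    have : 1 < m := by
      rw [hm, Int.lt_ceil, Int.cast_one, lt_div_iff₀ hd]
      linarith
    lia
  have hm_pos : (0 : ℝ) < m := by
    exact_mod_cast (by lia : 0 < m)
  have hle : C - L ≤ m * (L * (γ - 1)) := by
    rw [← div_le_iff₀ hd, hm]
    exact Int.le_ceil _
  have hlt : ((m : ℝ) - 1) * (L * (γ - 1)) < C - L := by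
    rw [← lt_div_iff₀ hd, sub_lt_iff_lt_add, hm]
    exact Int.ceil_lt_add_one _
  refine ⟨hm_two, ?_, ?_, ?_⟩
  · rw [hE, div_le_iff₀ hm_pos]
    linarith
  · rw [hE, mul_div_cancel₀ _ hm_pos.ne']
  · have : ((m : ℝ) - 1) * L ≤ C / (γ - 1) := by
      rw [le_div_iff₀ hγ']
      linarith
    rw [add_mul, one_mul, one_div_mul_eq_div]
    linarith
end

section
/- Let C, L, D be reals with C > L > 0 and D > L. Let m be a positive natural number and E_1, …, E_m reals with L < E_j ≤ D for all j and C + L·(m − 1) ≤ ∑_{j=1}^m E_j. Then m ≥ ⌈(C − L)/(D − L)⌉. -/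
/-- Any feasible reservation system (budgets in `(L, D]` satisfying the
reservation condition) uses at least `⌈(C − L)/(D − L)⌉` servers. -/
theorem stmt_12 (C L D : ℝ) (hL : 0 < L) (hCL : L < C) (hDL : L < D)
    (m : ℕ) (hm : 0 < m) (E : Fin m → ℝ)
    (hbudget : ∀ j, L < E j ∧ E j ≤ D)
    (hres : C + L * ((m : ℝ) - 1) ≤ ∑ j, E j) :
    ⌈(C - L) / (D - L)⌉ ≤ (m : ℤ) := by
  have hsum : ∑ j, E j ≤ m * D := by
    simpa using Finset.sum_le_card_nsmul Finset.univ E D fun j _ => (hbudget j).2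
  rw [Int.ceil_le, div_le_iff₀ (sub_pos.2 hDL), Int.cast_natCast]
  linarith
end

section
/- Let C, L, D be reals with C > L > 0 and D > L, and set m* = ⌈(C − L)/(D − L)⌉. For every positive natural number m and reals E_1, …, E_m with L < E_j ≤ D for all j and C + L·(m − 1) ≤ ∑_{j=1}^m E_j, the cumulative budget satisfies ∑_{j=1}^m E_j ≥ C + (m* − 1)·L. Hence the minimum cumulative reservation budget over all feasible reservation systems equals C + (m* − 1)·L, attained by the minimal number m* of servers. -/
/-- With `m* = ⌈(C − L)/(D − L)⌉`, every feasible reservation system has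
cumulative budget at least `C + (m* − 1)·L`, and this minimum is attained
by a feasible system with `m*` servers. -/
theorem stmt_13 (C L D : ℝ) (hL : 0 < L) (hCL : L < C) (hDL : L < D)
    (mstar : ℤ) (hmstar : mstar = ⌈(C - L) / (D - L)⌉) :
    (∀ (m : ℕ), 0 < m → ∀ E : Fin m → ℝ,
        (∀ j, L < E j ∧ E j ≤ D) →
        C + L * ((m : ℝ) - 1) ≤ ∑ j, E j →
        C + ((mstar : ℝ) - 1) * L ≤ ∑ j, E j) ∧
      ∃ (m : ℕ) (E : Fin m → ℝ), 0 < m ∧ (m : ℤ) = mstar ∧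
        (∀ j, L < E j ∧ E j ≤ D) ∧
        C + L * ((m : ℝ) - 1) ≤ ∑ j, E j ∧
        ∑ j, E j = C + ((mstar : ℝ) - 1) * L := by
  have hd : 0 < D - L := sub_pos.2 hDL
  refine ⟨fun m _ E hE hsum => ?_, ?_⟩
  · have hle : ∑ j, E j ≤ m * D := by
      simpa using Finset.sum_le_card_nsmul Finset.univ E D fun j _ => (hE j).2
    have hm : mstar ≤ (m : ℤ) := by
      rw [hmstar, Int.ceil_le, div_le_iff₀ hd]
      push_cast
      linarith
    have hm' : (mstar : ℝ) ≤ m := by exact_mod_cast hm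
    nlinarith
  · have hpos : 0 < mstar := by
      rw [hmstar, Int.ceil_pos]
      exact div_pos (sub_pos.2 hCL) hd
    have hceil : (C - L) / (D - L) ≤ mstar := hmstar ▸ Int.le_ceil _
    lift mstar to ℕ using hpos.le with m
    have hm : 0 < m := by exact_mod_cast hpos
    have hmR : (0 : ℝ) < m := by exact_mod_cast hm
    rw [Int.cast_natCast, div_le_iff₀ hd] at hceil
    have hsum : ∑ _j : Fin m, (L + (C - L) / m) = C + ((m : ℝ) - 1) * L := by
      simp only [Finset.sum_const, Finset.card_univ, Fintype.card_fin, nsmul_eq_mul]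
      field_simp
      ring
    refine ⟨m, fun _ => L + (C - L) / m, hm, rfl, fun _ => ⟨?_, ?_⟩, ?_, ?_⟩
    · exact lt_add_of_pos_right L (div_pos (sub_pos.2 hCL) hmR)
    · rw [← le_sub_iff_add_le', div_le_iff₀ hmR]
      linarith
    · rw [hsum, mul_comm]
    · rw [hsum, Int.cast_natCast]
end
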